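/- arXiv:2102.08822 — 3 statements merged into one kernel-verified Lean document; each statement's English description precedes it below -/
import Mathlib

section
/- For all real numbers κ > 0 and β > 1/2 there exists a constant C_κ > 0 such that for every integer L ≥ 1, (∑_{l=L+1}^∞ (2l+1)·(κ² + l(l+1))^{−2β})^{1/2} ≤ C_κ · (1/(2β−1) + 1/(4β−1)) · L^{1−2β}. -/
open Real

/-- Discrete form of `∫_{x}^{x+1} t ^ (-s - 1) dt = (x ^ (-s) - (x + 1) ^ (-s)) / s`. -/
lemma mul_rpow_neg_sub_one_le_sub {s x : ℝ} (hs : 0 < s) (hx : 0 < x) :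
    s * (x + 1) ^ (-s - 1) ≤ x ^ (-s) - (x + 1) ^ (-s) := by
  have hx1 : 0 < x + 1 := by linarith
  have hlog : 1 / (x + 1) ≤ log ((x + 1) / x) := by
    have h := one_sub_inv_le_log_of_pos (div_pos hx1 hx)
    have e : 1 - ((x + 1) / x)⁻¹ = 1 / (x + 1) := by field_simp; ring
    rwa [e] at h
  have hratio : 1 + s * (1 / (x + 1)) ≤ ((x + 1) / x) ^ s := by
    rw [rpow_def_of_pos (div_pos hx1 hx)]
    have h := add_one_le_exp (log ((x + 1) / x) * s)
    nlinarith [mul_le_mul_of_nonneg_left hlog hs.le]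
  have hpow : x ^ (-s) = (x + 1) ^ (-s) * ((x + 1) / x) ^ s := by
    rw [div_rpow hx1.le hx.le, rpow_neg hx.le, rpow_neg hx1.le]
    have := (rpow_pos_of_pos hx1 s).ne'
    field_simp
  rw [hpow, rpow_sub_one hx1.ne']
  have h := mul_le_mul_of_nonneg_left hratio (rpow_pos_of_pos hx1 (-s)).le
  calc s * ((x + 1) ^ (-s) / (x + 1))
      = (x + 1) ^ (-s) * (1 + s * (1 / (x + 1))) - (x + 1) ^ (-s) := by ring
    _ ≤ _ := by linarith

/-- The variance of degree `n` is dominated by a power of `n`. -/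
lemma two_mul_add_one_mul_rpow_le (κ : ℝ) {β x : ℝ} (hβ : 0 ≤ β) (hx : 1 ≤ x) :
    (2 * x + 1) * (κ ^ 2 + x * (x + 1)) ^ (-(2 * β)) ≤ 3 * x ^ (-(4 * β - 2) - 1) := by
  have hx0 : 0 < x := by linarith
  have hbase : (κ ^ 2 + x * (x + 1)) ^ (-(2 * β)) ≤ x ^ (-(4 * β)) := by
    calc (κ ^ 2 + x * (x + 1)) ^ (-(2 * β)) ≤ (x ^ (2 : ℝ)) ^ (-(2 * β)) := by
          refine rpow_le_rpow_of_nonpos (by positivity) ?_ (by linarith)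
          rw [rpow_two]
          nlinarith [sq_nonneg κ]
      _ = x ^ (-(4 * β)) := by
          rw [← rpow_mul hx0.le]
          congr 1
          ring
  calc (2 * x + 1) * (κ ^ 2 + x * (x + 1)) ^ (-(2 * β))
      ≤ (3 * x) * x ^ (-(4 * β)) := by
        gcongr
        linarith
    _ = 3 * x ^ (-(4 * β - 2) - 1) := by
        rw [show -(4 * β - 2) - 1 = -(4 * β) + 1 by ring, rpow_add_one hx0.ne']
        ring

/-- For all real numbers κ > 0 and β > 1/2 there exists a constant C_κ > 0 such that
for every integer L ≥ 1,
(∑_{l=L+1}^∞ (2l+1)·(κ² + l(l+1))^{−2β})^{1/2}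
  ≤ C_κ · (1/(2β−1) + 1/(4β−1)) · L^{1−2β}. -/
theorem stmt_3 (κ β : ℝ) (hκ : 0 < κ) (hβ : 1 / 2 < β) :
    ∃ C : ℝ, 0 < C ∧ ∀ L : ℕ, 1 ≤ L →
      (∑' l : ℕ, (2 * ((L + 1 + l : ℕ) : ℝ) + 1) *
          (κ ^ 2 + ((L + 1 + l : ℕ) : ℝ) * (((L + 1 + l : ℕ) : ℝ) + 1)) ^ (-(2 * β)))
          ^ ((1 : ℝ) / 2)
        ≤ C * (1 / (2 * β - 1) + 1 / (4 * β - 1)) * (L : ℝ) ^ (1 - 2 * β) := by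
  have hs : 0 < 4 * β - 2 := by linarith
  have hD : 0 < 1 / (2 * β - 1) + 1 / (4 * β - 1) :=
    add_pos (one_div_pos.2 (by linarith)) (one_div_pos.2 (by linarith))
  refine ⟨(3 / (4 * β - 2)) ^ ((1 : ℝ) / 2) / (1 / (2 * β - 1) + 1 / (4 * β - 1)),
    by positivity, fun L hL => ?_⟩
  have hL0 : (0 : ℝ) < L := by exact_mod_cast hL
  rw [div_mul_cancel₀ _ hD.ne', show 1 - 2 * β = -(4 * β - 2) * (1 / 2) by ring,
    rpow_mul hL0.le, ← mul_rpow (by positivity) (by positivity)]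
  refine rpow_le_rpow (tsum_nonneg fun l => by positivity) ?_ (by norm_num)
  refine Real.tsum_le_of_sum_range_le (fun l => by positivity) fun N => ?_
  calc _ ≤ ∑ l ∈ Finset.range N, (3 / (4 * β - 2) * ((L + l : ℕ) : ℝ) ^ (-(4 * β - 2)) -
        3 / (4 * β - 2) * ((L + (l + 1) : ℕ) : ℝ) ^ (-(4 * β - 2))) := by
        refine Finset.sum_le_sum fun l _ => ?_
        have hpos : (0 : ℝ) < ((L + l : ℕ) : ℝ) := by exact_mod_cast (by omega : 0 < L + l)
        have e₁ : ((L + 1 + l : ℕ) : ℝ) = ((L + l : ℕ) : ℝ) + 1 := by push_cast; ring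
        have e₂ : ((L + (l + 1) : ℕ) : ℝ) = ((L + l : ℕ) : ℝ) + 1 := by push_cast; ring
        rw [e₁, e₂, ← mul_sub]
        refine (two_mul_add_one_mul_rpow_le κ (by linarith) (by linarith)).trans ?_
        have h := mul_rpow_neg_sub_one_le_sub hs hpos
        rw [div_mul_eq_mul_div, le_div_iff₀ hs]
        linarith
    _ = 3 / (4 * β - 2) * (L : ℝ) ^ (-(4 * β - 2)) -
        3 / (4 * β - 2) * ((L + N : ℕ) : ℝ) ^ (-(4 * β - 2)) :=
        Finset.sum_range_sub' (fun l => 3 / (4 * β - 2) * ((L + l : ℕ) : ℝ) ^ (-(4 * β - 2))) N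
    _ ≤ _ := sub_le_self _ (by positivity)
end

section
/- Let λ > 0, α ∈ (0,1), k > 0 and K⁺ = ⌈π²/(4(1−α)k²)⌉. Then ∫_{kK⁺}^∞ e^{2αy}·(1 + λ·e^{2y})^{−1} dy ≤ e^{−π²/(2k)}/(2(1−α)·λ). -/
open MeasureTheory Real

/-- With K⁺ = ⌈π²/(4(1−α)k²)⌉,
∫_{kK⁺}^∞ e^{2αy}·(1 + λ·e^{2y})^{−1} dy ≤ e^{−π²/(2k)}/(2(1−α)·λ). -/
theorem stmt_9 (lam α k : ℝ) (hlam : 0 < lam) (hα : α ∈ Set.Ioo (0 : ℝ) 1) (hk : 0 < k)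
    (Kp : ℤ) (hKp : Kp = ⌈π ^ 2 / (4 * (1 - α) * k ^ 2)⌉) :
    ∫ y in Set.Ioi (k * Kp), Real.exp (2 * α * y) * (1 + lam * Real.exp (2 * y))⁻¹
      ≤ Real.exp (-π ^ 2 / (2 * k)) / (2 * (1 - α) * lam) := by
  have hα' : 0 < 1 - α := sub_pos.2 hα.2
  have ha : 2 * (α - 1) < 0 := by linarith
  have hle (y : ℝ) : exp (2 * α * y) * (1 + lam * exp (2 * y))⁻¹
      ≤ lam⁻¹ * exp (2 * (α - 1) * y) := by
    have hpos : 0 < lam * exp (2 * y) := by positivity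
    calc exp (2 * α * y) * (1 + lam * exp (2 * y))⁻¹
        ≤ exp (2 * α * y) * (lam * exp (2 * y))⁻¹ := by gcongr; linarith
      _ = lam⁻¹ * exp (2 * (α - 1) * y) := by
        rw [mul_inv, ← exp_neg, mul_left_comm, ← exp_add]
        ring_nf
  have hexp : 2 * (α - 1) * (k * Kp) ≤ -π ^ 2 / (2 * k) := by
    have hceil : π ^ 2 / (4 * (1 - α) * k ^ 2) ≤ Kp := hKp ▸ Int.le_ceil _
    calc 2 * (α - 1) * (k * Kp) = -(2 * (1 - α) * k * Kp) := by ring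
      _ ≤ -(2 * (1 - α) * k * (π ^ 2 / (4 * (1 - α) * k ^ 2))) := by gcongr
      _ = -π ^ 2 / (2 * k) := by field_simp; ring
  calc ∫ y in Set.Ioi (k * Kp), exp (2 * α * y) * (1 + lam * exp (2 * y))⁻¹
      ≤ ∫ y in Set.Ioi (k * Kp), lam⁻¹ * exp (2 * (α - 1) * y) :=
        integral_mono_of_nonneg (.of_forall fun y => by positivity)
          ((integrableOn_exp_mul_Ioi ha _).const_mul _) (.of_forall hle)
    _ = exp (2 * (α - 1) * (k * Kp)) / (2 * (1 - α) * lam) := by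
      rw [integral_const_mul, integral_exp_mul_Ioi ha, ← neg_sub 1 α, mul_neg, neg_div_neg_eq]
      field_simp
    _ ≤ exp (-π ^ 2 / (2 * k)) / (2 * (1 - α) * lam) := by gcongr
end

section
/- Let λ > 0, α ∈ (0,1), k > 0 and K⁻ = ⌈π²/(4αk²)⌉. Then ∫_{−∞}^{−kK⁻} e^{2αy}·(1 + λ·e^{2y})^{−1} dy ≤ e^{−π²/(2k)}/(2α). -/
open MeasureTheory Real

/-- With K⁻ = ⌈π²/(4αk²)⌉,
∫_{−∞}^{−kK⁻} e^{2αy}·(1 + λ·e^{2y})^{−1} dy ≤ e^{−π²/(2k)}/(2α). -/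
theorem stmt_10 (lam α k : ℝ) (hlam : 0 < lam) (hα : α ∈ Set.Ioo (0 : ℝ) 1) (hk : 0 < k)
    (Km : ℤ) (hKm : Km = ⌈π ^ 2 / (4 * α * k ^ 2)⌉) :
    ∫ y in Set.Iio (-(k * Km)), Real.exp (2 * α * y) * (1 + lam * Real.exp (2 * y))⁻¹
      ≤ Real.exp (-π ^ 2 / (2 * k)) / (2 * α) := by
  obtain ⟨hα0, -⟩ := hα
  have h2α : 0 < 2 * α := by positivity
  have hint : IntegrableOn (fun y : ℝ => Real.exp (2 * α * y)) (Set.Iio (-(k * Km))) :=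
    (integrableOn_exp_mul_Iic h2α _).mono_set Set.Iio_subset_Iic_self
  have hceil : π ^ 2 / (4 * α * k ^ 2) ≤ Km := hKm ▸ Int.le_ceil _
  have hexp : 2 * α * -(k * Km) ≤ -π ^ 2 / (2 * k) := by
    have h := mul_le_mul_of_nonneg_left hceil (by positivity : 0 ≤ 2 * α * k)
    have heq : 2 * α * k * (π ^ 2 / (4 * α * k ^ 2)) = π ^ 2 / (2 * k) := by
      field_simp
      norm_num
    rw [heq] at h
    rw [neg_div]
    linarith
  calc
    ∫ y in Set.Iio (-(k * Km)), Real.exp (2 * α * y) * (1 + lam * Real.exp (2 * y))⁻¹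
        ≤ ∫ y in Set.Iio (-(k * Km)), Real.exp (2 * α * y) := by
      refine integral_mono_of_nonneg (.of_forall fun y => ?_) hint (.of_forall fun y => ?_)
      · dsimp only [Pi.zero_apply]
        positivity
      · refine mul_le_of_le_one_right (Real.exp_pos _).le (inv_le_one_of_one_le₀ ?_)
        exact le_add_of_nonneg_right (by positivity)
    _ = Real.exp (2 * α * -(k * Km)) / (2 * α) := by
      rw [← integral_Iic_eq_integral_Iio, integral_exp_mul_Iic h2α]
    _ ≤ Real.exp (-π ^ 2 / (2 * k)) / (2 * α) := by gcongr
end
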